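/- (Durrleman's condition implies convexity in strike.) Fix S > 0 and r = δ = 0, and let ω : ℝ → (0, ∞) be twice differentiable. Define the call price surface at fixed maturity by c(K) = S Φ(d₊(k)) − K Φ(d₋(k)) for K > 0, where k = log(K/S) and d±(k) = −k/√ω(k) ± √ω(k)/2. Then c is twice differentiable on (0, ∞) with c''(K) = φ(d₋(k)) g(k)/(K √ω(k)), where g(k) = (1 − k ω'(k)/(2ω(k)))² − (ω'(k)²/4)(1/ω(k) + 1/4) + ω''(k)/2 is Durrleman's quantity. Consequently, if g(k) ≥ 0 for all k ∈ ℝ, then c is convex on (0, ∞). -/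

import Mathlib

open Real Filter Set

/-- Standard normal CDF. -/
noncomputable def stdNormalCDF (x : ℝ) : ℝ :=
  (Real.sqrt (2 * Real.pi))⁻¹ * ∫ t in Set.Iic x, Real.exp (-t ^ 2 / 2)

/-- Standard normal density. -/
noncomputable def stdNormalPDF (x : ℝ) : ℝ :=
  (Real.sqrt (2 * Real.pi))⁻¹ * Real.exp (-x ^ 2 / 2)

/-- d₊ in the Black–Scholes formula. -/
noncomputable def dPlus (S σ r δ K τ : ℝ) : ℝ :=
  (Real.log (S / K) + (r - δ) * τ) / (σ * Real.sqrt τ) + σ * Real.sqrt τ / 2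

/-- d₋ in the Black–Scholes formula. -/
noncomputable def dMinus (S σ r δ K τ : ℝ) : ℝ :=
  (Real.log (S / K) + (r - δ) * τ) / (σ * Real.sqrt τ) - σ * Real.sqrt τ / 2

/-- Black–Scholes call price. -/
noncomputable def bsCall (S σ r δ K τ : ℝ) : ℝ :=
  S * Real.exp (-δ * τ) * stdNormalCDF (dPlus S σ r δ K τ)
    - K * Real.exp (-r * τ) * stdNormalCDF (dMinus S σ r δ K τ)

/-- Durrleman's quantity for a total variance smile `ω` with first and second
derivatives `ω'` and `ω''`. -/
noncomputable def durrleman (ω ω' ω'' : ℝ → ℝ) (k : ℝ) : ℝ :=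
  (1 - k * ω' k / (2 * ω k)) ^ 2 - (ω' k) ^ 2 / 4 * (1 / ω k + 1 / 4) + ω'' k / 2

/-- `d₊` of a smile at log moneyness `k`. -/
noncomputable def smileDPlus (ω : ℝ → ℝ) (k : ℝ) : ℝ :=
  -k / Real.sqrt (ω k) + Real.sqrt (ω k) / 2

/-- `d₋` of a smile at log moneyness `k`. -/
noncomputable def smileDMinus (ω : ℝ → ℝ) (k : ℝ) : ℝ :=
  -k / Real.sqrt (ω k) - Real.sqrt (ω k) / 2

/-- Call price surface at fixed maturity with total variance smile `ω`, zero rates. -/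
noncomputable def smileCall (S : ℝ) (ω : ℝ → ℝ) (K : ℝ) : ℝ :=
  S * stdNormalCDF (smileDPlus ω (Real.log (K / S)))
    - K * stdNormalCDF (smileDMinus ω (Real.log (K / S)))

theorem aux_int : MeasureTheory.Integrable (fun t : ℝ => Real.exp (-t ^ 2 / 2)) := by
  have h := integrable_exp_neg_mul_sq (b := 1 / 2) (by norm_num)
  refine h.congr (Filter.Eventually.of_forall fun t => ?_)
  show Real.exp _ = Real.exp _
  congr 1
  ring

theorem aux_cdf (x : ℝ) : HasDerivAt stdNormalCDF (stdNormalPDF x) x := by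
  have hc : Continuous (fun t : ℝ => Real.exp (-t ^ 2 / 2)) := by fun_prop
  have h1 : HasDerivAt (fun u => ∫ t in (0 : ℝ)..u, Real.exp (-t ^ 2 / 2))
      (Real.exp (-x ^ 2 / 2)) x :=
    intervalIntegral.integral_hasDerivAt_right (hc.intervalIntegrable _ _)
      hc.stronglyMeasurable.stronglyMeasurableAtFilter hc.continuousAt
  have h2 := ((h1.const_add (∫ t in Set.Iic (0 : ℝ), Real.exp (-t ^ 2 / 2)))).const_mul
    (Real.sqrt (2 * Real.pi))⁻¹
  refine h2.congr_of_eventuallyEq (Filter.Eventually.of_forall fun u => ?_)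
  have := intervalIntegral.integral_Iic_sub_Iic (aux_int.integrableOn (s := Set.Iic (0 : ℝ)))
    (aux_int.integrableOn (s := Set.Iic u))
  simp only [stdNormalCDF]
  rw [← this]
  ring

theorem aux_pdf (x : ℝ) : HasDerivAt stdNormalPDF (-x * stdNormalPDF x) x := by
  have h : HasDerivAt (fun x : ℝ => -x ^ 2 / 2) (-x) x := by
    have := ((hasDerivAt_pow 2 x).neg).div_const 2
    refine this.congr_deriv ?_
    norm_num
    try ring
  have h2 := (h.exp).const_mul (Real.sqrt (2 * Real.pi))⁻¹
  refine h2.congr_deriv ?_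
  simp only [stdNormalPDF]
  ring

theorem aux_s (ω ω' : ℝ → ℝ) (hωpos : ∀ k : ℝ, 0 < ω k)
    (hω : ∀ k : ℝ, HasDerivAt ω (ω' k) k) (k : ℝ) :
    HasDerivAt (fun k => Real.sqrt (ω k)) (ω' k / (2 * Real.sqrt (ω k))) k :=
  (hω k).sqrt (hωpos k).ne'

theorem aux_q (ω ω' : ℝ → ℝ) (hωpos : ∀ k : ℝ, 0 < ω k)
    (hω : ∀ k : ℝ, HasDerivAt ω (ω' k) k) (k : ℝ) :
    HasDerivAt (fun k => -k / Real.sqrt (ω k))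
      (-1 / Real.sqrt (ω k) + k * ω' k / (2 * Real.sqrt (ω k) ^ 3)) k := by
  have hs := Real.sqrt_pos.2 (hωpos k)
  have := (hasDerivAt_id k).neg.div (aux_s ω ω' hωpos hω k) hs.ne'
  refine this.congr_deriv ?_
  simp only [id, Pi.neg_apply]
  field_simp
  ring

theorem aux_dm (ω ω' : ℝ → ℝ) (hωpos : ∀ k : ℝ, 0 < ω k)
    (hω : ∀ k : ℝ, HasDerivAt ω (ω' k) k) (k : ℝ) :
    HasDerivAt (smileDMinus ω)
      (-1 / Real.sqrt (ω k) + k * ω' k / (2 * Real.sqrt (ω k) ^ 3)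
        - ω' k / (2 * Real.sqrt (ω k)) / 2) k :=
  (aux_q ω ω' hωpos hω k).sub ((aux_s ω ω' hωpos hω k).div_const 2)

theorem aux_dp (ω ω' : ℝ → ℝ) (hωpos : ∀ k : ℝ, 0 < ω k)
    (hω : ∀ k : ℝ, HasDerivAt ω (ω' k) k) (k : ℝ) :
    HasDerivAt (smileDPlus ω)
      (-1 / Real.sqrt (ω k) + k * ω' k / (2 * Real.sqrt (ω k) ^ 3)
        + ω' k / (2 * Real.sqrt (ω k)) / 2) k :=
  (aux_q ω ω' hωpos hω k).add ((aux_s ω ω' hωpos hω k).div_const 2)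

theorem aux_log (S : ℝ) (hS : 0 < S) (K : ℝ) (hK : 0 < K) :
    HasDerivAt (fun K => Real.log (K / S)) (1 / K) K := by
  have := ((hasDerivAt_id K).div_const S).log (by simp only [id]; positivity)
  refine this.congr_deriv ?_
  simp only [id]
  field_simp

theorem aux_phi (S : ℝ) (hS : 0 < S) (ω : ℝ → ℝ) (hωpos : ∀ k : ℝ, 0 < ω k)
    (K : ℝ) (hK : 0 < K) :
    S * stdNormalPDF (smileDPlus ω (Real.log (K / S)))
      = K * stdNormalPDF (smileDMinus ω (Real.log (K / S))) := by
  have hKS : K = S * Real.exp (Real.log (K / S)) := by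
    rw [Real.exp_log (by positivity)]; field_simp
  generalize Real.log (K / S) = k at *
  have hs := Real.sqrt_pos.2 (hωpos k)
  rw [hKS]
  simp only [stdNormalPDF, smileDPlus, smileDMinus]
  have : -(-k / Real.sqrt (ω k) + Real.sqrt (ω k) / 2) ^ 2 / 2
      = k + -(-k / Real.sqrt (ω k) - Real.sqrt (ω k) / 2) ^ 2 / 2 := by
    field_simp
    ring
  rw [this, Real.exp_add]
  ring

theorem aux_c1 (S : ℝ) (hS : 0 < S) (ω ω' : ℝ → ℝ) (hωpos : ∀ k : ℝ, 0 < ω k)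
    (hω : ∀ k : ℝ, HasDerivAt ω (ω' k) k) (K : ℝ) (hK : 0 < K) :
    HasDerivAt (smileCall S ω)
      ((fun k => stdNormalPDF (smileDMinus ω k) * (ω' k / (2 * Real.sqrt (ω k)))
        - stdNormalCDF (smileDMinus ω k)) (Real.log (K / S))) K := by
  have hl := aux_log S hS K hK
  have hp := (aux_cdf _).comp K ((aux_dp ω ω' hωpos hω (Real.log (K / S))).comp K hl)
  have hm := (aux_cdf _).comp K ((aux_dm ω ω' hωpos hω (Real.log (K / S))).comp K hl)
  have h := (hp.const_mul S).sub ((hasDerivAt_id K).mul hm)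
  refine HasDerivAt.congr_deriv (f := smileCall S ω) h ?_
  have e := aux_phi S hS ω hωpos K hK
  simp only [id, Function.comp]
  rw [← mul_assoc, e]
  have hs := Real.sqrt_pos.2 (hωpos (Real.log (K / S)))
  generalize Real.log (K / S) = k at *
  field_simp
  ring

theorem aux_c2 (S : ℝ) (hS : 0 < S) (ω ω' ω'' : ℝ → ℝ) (hωpos : ∀ k : ℝ, 0 < ω k)
    (hω : ∀ k : ℝ, HasDerivAt ω (ω' k) k)
    (hω' : ∀ k : ℝ, HasDerivAt ω' (ω'' k) k) (K : ℝ) (hK : 0 < K) :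
    HasDerivAt (deriv (smileCall S ω))
        (stdNormalPDF (smileDMinus ω (Real.log (K / S)))
          * durrleman ω ω' ω'' (Real.log (K / S))
          / (K * Real.sqrt (ω (Real.log (K / S))))) K := by
  have hl := aux_log S hS K hK
  set k := Real.log (K / S) with hk
  have hs := Real.sqrt_pos.2 (hωpos k)
  have hm := aux_dm ω ω' hωpos hω k
  have h := ((((aux_pdf _).comp k hm).mul
    ((hω' k).div ((aux_s ω ω' hωpos hω k).const_mul 2) (by positivity))).sub
    ((aux_cdf _).comp k hm)).comp K hl
  have h2 := h.congr_of_eventuallyEq (f₁ := deriv (smileCall S ω)) (by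
    filter_upwards [lt_mem_nhds hK] with x hx
    exact (aux_c1 S hS ω ω' hωpos hω x hx).deriv)
  refine h2.congr_deriv ?_
  have hw : ω k = Real.sqrt (ω k) ^ 2 := (Real.sq_sqrt (hωpos k).le).symm
  simp only [Function.comp, durrleman, Pi.div_apply]
  generalize stdNormalPDF (smileDMinus ω k) = p
  simp only [smileDMinus]
  generalize hsd : Real.sqrt (ω k) = s at *
  rw [hw]
  field_simp
  ring

/-- Durrleman's condition implies convexity of the call price in the strike: the call
price surface is twice differentiable with second derivative `φ(d₋) g(k)/(K √ω(k))`,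
and if Durrleman's quantity `g` is nonnegative then the price is convex in the strike. -/
theorem stmt_15 (S : ℝ) (hS : 0 < S) (ω ω' ω'' : ℝ → ℝ)
    (hωpos : ∀ k : ℝ, 0 < ω k)
    (hω : ∀ k : ℝ, HasDerivAt ω (ω' k) k)
    (hω' : ∀ k : ℝ, HasDerivAt ω' (ω'' k) k) :
    (∀ K : ℝ, 0 < K →
      DifferentiableAt ℝ (smileCall S ω) K ∧
      HasDerivAt (deriv (smileCall S ω))
        (stdNormalPDF (smileDMinus ω (Real.log (K / S)))
          * durrleman ω ω' ω'' (Real.log (K / S))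
          / (K * Real.sqrt (ω (Real.log (K / S))))) K) ∧
    ((∀ k : ℝ, 0 ≤ durrleman ω ω' ω'' k) →
      ConvexOn ℝ (Set.Ioi 0) (smileCall S ω)) := by
  have h2 := aux_c2 S hS ω ω' ω'' hωpos hω hω'
  have h1 := aux_c1 S hS ω ω' hωpos hω
  refine ⟨fun K hK => ⟨(h1 K hK).differentiableAt, h2 K hK⟩, fun hg => ?_⟩
  refine convexOn_of_deriv2_nonneg (convex_Ioi 0)
    (fun K hK => (h1 K hK).continuousAt.continuousWithinAt) ?_ ?_ ?_
  · intro K hK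
    rw [interior_Ioi] at hK
    exact (h1 K hK).differentiableAt.differentiableWithinAt
  · intro K hK
    rw [interior_Ioi] at hK
    exact (h2 K hK).differentiableAt.differentiableWithinAt
  · intro K hK
    rw [interior_Ioi] at hK
    have hK' : 0 < K := hK
    have e : deriv^[2] (smileCall S ω) K = deriv (deriv (smileCall S ω)) K := rfl
    rw [e, (h2 K hK).deriv]
    have := hg (Real.log (K / S))
    have hp : 0 ≤ stdNormalPDF (smileDMinus ω (Real.log (K / S))) := by
      unfold stdNormalPDF
      positivity
    positivity
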